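/- Let (Q,h) be a floor plan with Q = (q₁,…,q_r) and B(Q,h) ⊆ Q. Let M be the set of indices i such that qᵢ is a maximal element of supp(Q,h) for the componentwise partial order. Define h'ᵢ = hᵢ − 1 for i ∈ M and h'ᵢ = hᵢ otherwise, and let (Q',h') be the floor plan obtained from (Q,h') by deleting all indices i with h'ᵢ = 0. Then maxscore_{(Q',h')}(q) ≤ maxscore_{(Q,h)}(q) − 1 for every q ∈ supp(Q,h). -/

import Mathlib

/-! Common definitions: 3-dimensional Young diagrams, towers, floor plans. -/

/-- Points of `ℤ³` (in which our three-dimensional Young diagrams live). -/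
abbrev Pt3 := ℤ × ℤ × ℤ

/-- Points of `ℕ²` (in which floor plans live). -/
abbrev Pt2 := ℕ × ℕ

/-- The `1 × 1 × m` shape `νᵢ = {(0,0,z) : 0 ≤ z < m}`. -/
def nuShape (m : ℕ) : Set Pt3 :=
  {p | p.1 = 0 ∧ p.2.1 = 0 ∧ 0 ≤ p.2.2 ∧ p.2.2 < (m : ℤ)}

/-- The translate `s + b` of a subset `s ⊆ ℤ³`. -/
def translate3 (s : Set Pt3) (b : Pt3) : Set Pt3 := (fun v => v + b) '' s

/-- A three-dimensional Young diagram: a finite subset of `ℕ³ ⊆ ℤ³` which is downward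
closed for the componentwise order. -/
def IsYoung3 (l : Set Pt3) : Prop :=
  l.Finite ∧ (∀ p ∈ l, 0 ≤ p) ∧ ∀ p ∈ l, ∀ q : Pt3, 0 ≤ q → q ≤ p → q ∈ l

/-- `(l, n, b)` is a tower: `l` is a 3-dimensional Young diagram, the shapes
`νᵢ = nuShape (n i)` (with `n i ≥ 1`) have pairwise disjoint translates `νᵢ + bᵢ`
contained in `l`, and for all `w ∈ ℕ³` and `v ∈ νᵢ` with `v + bᵢ + w ∈ l` one has
`v + w ∈ νᵢ`. -/
def IsTower (l : Set Pt3) {r : ℕ} (n : Fin r → ℕ) (b : Fin r → Pt3) : Prop :=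
  IsYoung3 l ∧ (∀ i, 1 ≤ n i) ∧
  (∀ i j, i ≠ j →
    Disjoint (translate3 (nuShape (n i)) (b i)) (translate3 (nuShape (n j)) (b j))) ∧
  (∀ i, translate3 (nuShape (n i)) (b i) ⊆ l) ∧
  (∀ i, ∀ v ∈ nuShape (n i), ∀ w : Pt3, 0 ≤ w → v + b i + w ∈ l → v + w ∈ nuShape (n i))

/-- A compatible tower `(λ, μ, ν, b, c)`. -/
def IsCompatibleTower (l m : Set Pt3) {r : ℕ} (n : Fin r → ℕ) (b c : Fin r → Pt3) : Prop :=
  IsTower l n b ∧ IsTower m n c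

/-- The order ideal `⟨T⟩ = {v ∈ ℕ³ : v ≤ t for some t ∈ T}` generated by `T ⊆ ℤ³`. -/
def orderIdeal (T : Set Pt3) : Set Pt3 := {v | 0 ≤ v ∧ ∃ t ∈ T, v ≤ t}

/-- A tower `(l, n, b)` is scaffolded if `l = ⟨⋃ᵢ (νᵢ + bᵢ)⟩`. -/
def IsScaffolded (l : Set Pt3) {r : ℕ} (n : Fin r → ℕ) (b : Fin r → Pt3) : Prop :=
  l = orderIdeal (⋃ i, translate3 (nuShape (n i)) (b i))

/-- The partial order on compatible towers: `(l,m,ν,b,c) ≤ (l',m',ν',b',c')` iff `l ⊆ l'`,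
`m ⊆ m'`, there is an injection `ι` of index sets with `νᵢ ⊆ ν'_{ι i}`, and
`|l∩m| − |ν| ≤ |l'∩m'| − |ν'|` (computed in `ℤ`). -/
def CompTowerLE (l m : Set Pt3) {r : ℕ} (n : Fin r → ℕ)
    (l' m' : Set Pt3) {r' : ℕ} (n' : Fin r' → ℕ) : Prop :=
  l ⊆ l' ∧ m ⊆ m' ∧
  (∃ ι : Fin r ↪ Fin r', ∀ i, nuShape (n i) ⊆ nuShape (n' (ι i))) ∧
  ((l ∩ m).ncard : ℤ) - (∑ i, (n i : ℤ)) ≤ ((l' ∩ m').ncard : ℤ) - (∑ i, (n' i : ℤ))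

/-! Floor plans. -/

/-- A single North-East step. -/
def IsNEStep (q q' : Pt2) : Prop := q' = (q.1 + 1, q.2) ∨ q' = (q.1, q.2 + 1)

/-- A (nonempty) North-East path in `ℕ²`, recorded as the list of its lattice points. -/
def IsNEPath (γ : List Pt2) : Prop := γ ≠ [] ∧ γ.Chain' IsNEStep

/-- The score of a path `γ` with respect to the floor plan `(P, h)`. -/
def score {r : ℕ} (P : Fin r → Pt2) (h : Fin r → ℕ) (γ : List Pt2) : ℕ :=
  ∑ i, if P i ∈ γ then h i else 0

/-- The maximal score of a North-East path originating at `q`. -/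
noncomputable def maxscore {r : ℕ} (P : Fin r → Pt2) (h : Fin r → ℕ) (q : Pt2) : ℕ :=
  sSup {s | ∃ γ : List Pt2, IsNEPath γ ∧ γ.head? = some q ∧ score P h γ = s}

/-- A winning path for `q`: a North-East path originating at `q` attaining `maxscore`. -/
def IsWinningPath {r : ℕ} (P : Fin r → Pt2) (h : Fin r → ℕ) (q : Pt2) (γ : List Pt2) : Prop :=
  IsNEPath γ ∧ γ.head? = some q ∧ score P h γ = maxscore P h q

/-- A floor plan: pairwise distinct points `pᵢ ∈ ℕ²` together with positive heights `hᵢ`. -/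
def IsFloorPlan {r : ℕ} (P : Fin r → Pt2) (h : Fin r → ℕ) : Prop :=
  Function.Injective P ∧ ∀ i, 1 ≤ h i

/-- The support of a floor plan. -/
def suppFP {r : ℕ} (P : Fin r → Pt2) (h : Fin r → ℕ) : Set Pt2 :=
  {q | 0 < maxscore P h q}

/-- The border of a floor plan. -/
def borderFP {r : ℕ} (P : Fin r → Pt2) (h : Fin r → ℕ) : Set Pt2 :=
  {q ∈ suppFP P h | (q.1 + 1, q.2) ∉ suppFP P h ∨ (q.1, q.2 + 1) ∉ suppFP P h}

/-- The three-dimensional Young diagram `λ` of the minimal realization `𝒯(P,h)`: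
its height function is `H_λ(q) = maxscore (P,h) (q)`. -/
def Tlam {r : ℕ} (P : Fin r → Pt2) (h : Fin r → ℕ) : Set Pt3 :=
  {p | 0 ≤ p ∧ p.2.2 < (maxscore P h (p.1.toNat, p.2.1.toNat) : ℤ)}

/-- The base points `bᵢ = (pᵢ, maxscore(pᵢ) − hᵢ)` of the minimal realization `𝒯(P,h)`. -/
noncomputable def Tb {r : ℕ} (P : Fin r → Pt2) (h : Fin r → ℕ) (i : Fin r) : Pt3 :=
  (((P i).1 : ℤ), ((P i).2 : ℤ), (maxscore P h (P i) : ℤ) - (h i : ℤ))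

/-- A floor plan `(P,h)` is minimal (w.r.t. the order `(P',h) ≤ (P,h) ↔ λ' ⊆ λ`). -/
def MinimalFP {r : ℕ} (P : Fin r → Pt2) (h : Fin r → ℕ) : Prop :=
  IsFloorPlan P h ∧
  ∀ P' : Fin r → Pt2, IsFloorPlan P' h → Tlam P' h ⊆ Tlam P h → Tlam P h ⊆ Tlam P' h

/-- A compatible floor plan `(P,Q,h)` is minimal (w.r.t. the order on compatible floor plans
given by `𝒯(P,Q,h) ≤ 𝒯(P',Q',h')` in the partial order on compatible towers). -/
def MinimalCFP {r : ℕ} (P Q : Fin r → Pt2) (h : Fin r → ℕ) : Prop :=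
  IsFloorPlan P h ∧ IsFloorPlan Q h ∧
  ∀ (r' : ℕ) (P' Q' : Fin r' → Pt2) (h' : Fin r' → ℕ),
    IsFloorPlan P' h' → IsFloorPlan Q' h' →
    CompTowerLE (Tlam P' h') (Tlam Q' h') h' (Tlam P h) (Tlam Q h) h →
    CompTowerLE (Tlam P h) (Tlam Q h) h (Tlam P' h') (Tlam Q' h') h'
section MaxScore

variable {r : ℕ} {P : Fin r → Pt2} {h : Fin r → ℕ}

theorem IsNEStep.lt {q q' : Pt2} (hs : IsNEStep q q') : q < q' := by
  rw [Prod.lt_iff]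
  rcases hs with rfl | rfl <;> simp

theorem notMem_of_isNEPath_cons {q : Pt2} {t : List Pt2} (hγ : IsNEPath (q :: t)) : q ∉ t := by
  have hlt : (q :: t).IsChain (· < ·) := List.IsChain.imp (fun _ _ hs => IsNEStep.lt hs) hγ.2
  intro hq
  exact lt_irrefl q ((List.pairwise_cons.1 (List.isChain_iff_pairwise.1 hlt)).1 q hq)

theorem score_cons {q : Pt2} {t : List Pt2} (hq : q ∉ t) :
    score P h (q :: t) = score P h [q] + score P h t := by
  simp only [score, ← Finset.sum_add_distrib]
  refine Finset.sum_congr rfl fun i _ => ?_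
  by_cases hi : P i = q
  · simp [hi, hq]
  · simp [hi]

theorem score_mono {h₁ h₂ : Fin r → ℕ} (hle : ∀ i, h₁ i ≤ h₂ i) (γ : List Pt2) :
    score P h₁ γ ≤ score P h₂ γ := by
  refine Finset.sum_le_sum fun i _ => ?_
  split_ifs
  · exact hle i
  · exact le_rfl

theorem score_lt_score {h₁ h₂ : Fin r → ℕ} (hle : ∀ i, h₁ i ≤ h₂ i) {γ : List Pt2} {i : Fin r}
    (hi : P i ∈ γ) (hlt : h₁ i < h₂ i) : score P h₁ γ < score P h₂ γ := by
  refine Finset.sum_lt_sum (fun j _ => ?_) ⟨i, Finset.mem_univ i, by simpa [hi] using hlt⟩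
  split_ifs
  · exact hle j
  · exact le_rfl

theorem score_comp_le {r' : ℕ} {e : Fin r' → Fin r} (he : Function.Injective e) (γ : List Pt2) :
    score (P ∘ e) (h ∘ e) γ ≤ score P h γ := by
  calc score (P ∘ e) (h ∘ e) γ
      = ∑ i ∈ Finset.univ.map ⟨e, he⟩, if P i ∈ γ then h i else 0 := by
        simp [score, Finset.sum_map]
    _ ≤ score P h γ := Finset.sum_le_sum_of_subset (Finset.subset_univ _)

theorem bddAbove_scores (P : Fin r → Pt2) (h : Fin r → ℕ) (q : Pt2) :
    BddAbove {s | ∃ γ : List Pt2, IsNEPath γ ∧ γ.head? = some q ∧ score P h γ = s} := by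
  refine ⟨∑ i, h i, ?_⟩
  rintro _ ⟨γ, -, -, rfl⟩
  refine Finset.sum_le_sum fun i _ => ?_
  split_ifs <;> simp

theorem nonempty_scores (P : Fin r → Pt2) (h : Fin r → ℕ) (q : Pt2) :
    {s | ∃ γ : List Pt2, IsNEPath γ ∧ γ.head? = some q ∧ score P h γ = s}.Nonempty :=
  ⟨_, [q], ⟨by simp, List.isChain_singleton q⟩, rfl, rfl⟩

theorem score_le_maxscore {q : Pt2} {γ : List Pt2} (hγ : IsNEPath γ) (hq : γ.head? = some q) :
    score P h γ ≤ maxscore P h q :=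
  le_csSup (bddAbove_scores P h q) ⟨γ, hγ, hq, rfl⟩

theorem exists_isWinningPath (P : Fin r → Pt2) (h : Fin r → ℕ) (q : Pt2) :
    ∃ γ, IsWinningPath P h q γ :=
  Nat.sSup_mem (nonempty_scores P h q) (bddAbove_scores P h q)

theorem score_add_maxscore_le {q q' : Pt2} (hs : IsNEStep q q') :
    score P h [q] + maxscore P h q' ≤ maxscore P h q := by
  obtain ⟨γ, ⟨-, hc⟩, hhead, hscore⟩ := exists_isWinningPath P h q'
  have hpath : IsNEPath (q :: γ) :=
    ⟨by simp, List.isChain_cons.2 ⟨fun y hy => by simp_all, hc⟩⟩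
  rw [← hscore, ← score_cons (notMem_of_isNEPath_cons hpath)]
  exact score_le_maxscore hpath rfl

theorem maxscore_antitone (P : Fin r → Pt2) (h : Fin r → ℕ) : Antitone (maxscore P h) := by
  have hstep {q q' : Pt2} (hs : IsNEStep q q') : maxscore P h q' ≤ maxscore P h q :=
    le_trans (Nat.le_add_left _ _) (score_add_maxscore_le hs)
  rintro ⟨a, b⟩ ⟨c, d⟩ ⟨hac, hbd⟩
  exact (antitone_nat_of_succ_le (f := fun x => maxscore P h (x, d))
    (fun x => hstep (Or.inl rfl)) hac).trans
    (antitone_nat_of_succ_le (f := fun y => maxscore P h (a, y))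
      (fun y => hstep (Or.inr rfl)) hbd)

theorem exists_isNEStep_mem_suppFP {q y : Pt2} (hy : y ∈ suppFP P h) (hlt : q < y) :
    ∃ q', IsNEStep q q' ∧ q' ∈ suppFP P h := by
  rcases Prod.lt_iff.1 hlt with ⟨h₁, h₂⟩ | ⟨h₁, h₂⟩
  · exact ⟨_, Or.inl rfl,
      lt_of_lt_of_le hy (maxscore_antitone P h (Prod.mk_le_mk.2 ⟨Nat.succ_le_of_lt h₁, h₂⟩))⟩
  · exact ⟨_, Or.inr rfl,
      lt_of_lt_of_le hy (maxscore_antitone P h (Prod.mk_le_mk.2 ⟨h₁, Nat.succ_le_of_lt h₂⟩))⟩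

/-- A path starting in the support and avoiding its maximal elements is not winning. -/
theorem score_lt_maxscore_of_forall_not_maximal {q : Pt2} {γ : List Pt2} (hγ : IsNEPath γ)
    (hhead : γ.head? = some q) (hq : q ∈ suppFP P h)
    (hmax : ∀ p ∈ γ, ¬ Maximal (· ∈ suppFP P h) p) :
    score P h γ < maxscore P h q := by
  induction γ generalizing q with
  | nil => simp at hhead
  | cons a t ih =>
    obtain rfl : a = q := by simpa using hhead
    have hlt : score P h [a] < maxscore P h a := by
      obtain ⟨y, hay, hy⟩ := (not_maximal_iff_exists_gt hq).1 (hmax a (by simp))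
      obtain ⟨q', hs, hq'⟩ := exists_isNEStep_mem_suppFP hy hay
      have hle := score_add_maxscore_le (P := P) (h := h) hs
      have hpos : 0 < maxscore P h q' := hq'
      omega
    cases t with
    | nil => exact hlt
    | cons b t =>
      obtain ⟨hs, hc⟩ := List.isChain_cons_cons.1 hγ.2
      have hpath : IsNEPath (b :: t) := ⟨by simp, hc⟩
      rw [score_cons (notMem_of_isNEPath_cons hγ)]
      have hle := score_add_maxscore_le (P := P) (h := h) hs
      by_cases hb : b ∈ suppFP P h
      · have := ih hpath rfl hb fun p hp => hmax p (List.mem_cons_of_mem _ hp)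
        omega
      · have hzero : ¬ 0 < maxscore P h b := hb
        have := score_le_maxscore (P := P) (h := h) hpath rfl
        omega

theorem mem_borderFP_of_maximal {m : Pt2} (hm : Maximal (· ∈ suppFP P h) m) :
    m ∈ borderFP P h :=
  ⟨hm.prop, Or.inl (hm.not_prop_of_gt (IsNEStep.lt (Or.inl rfl)))⟩

end MaxScore

open Classical in
/-- **Lowering the heights at maximal support points lowers every max score** (from the
proof of Theorem 2.9). Let `(Q,h)` be a floor plan with `B(Q,h) ⊆ Q`, let `M` be the set
of indices `i` such that `qᵢ` is a maximal element of `supp(Q,h)`, let `h'ᵢ = hᵢ − 1` for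
`i ∈ M` and `h'ᵢ = hᵢ` otherwise, and let `(Q∘e, h'∘e)` be the floor plan obtained by
deleting all indices with `h'ᵢ = 0` (so `e` enumerates `{i : h'ᵢ ≠ 0}` injectively). Then
`maxscore_{(Q',h')}(q) ≤ maxscore_{(Q,h)}(q) − 1` for every `q ∈ supp(Q,h)`. -/
theorem lowered_maxscore {r : ℕ} (Q : Fin r → Pt2) (h : Fin r → ℕ)
    (hfp : IsFloorPlan Q h) (hb : borderFP Q h ⊆ Set.range Q)
    (h' : Fin r → ℕ)
    (hh' : ∀ i, h' i =
      if Q i ∈ suppFP Q h ∧ ∀ y ∈ suppFP Q h, Q i ≤ y → y = Q i then h i - 1 else h i)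
    (r' : ℕ) (e : Fin r' → Fin r) (he : Function.Injective e)
    (hrange : Set.range e = {i | h' i ≠ 0})
    (q : Pt2) (hq : q ∈ suppFP Q h) :
    maxscore (Q ∘ e) (h' ∘ e) q ≤ maxscore Q h q - 1 := by
  have hle : ∀ i, h' i ≤ h i := fun i => by
    rw [hh' i]
    split_ifs <;> omega
  obtain ⟨γ, hγ, hhead, hscore⟩ := exists_isWinningPath (Q ∘ e) (h' ∘ e) q
  rw [← hscore]
  refine Nat.le_sub_one_of_lt ((score_comp_le he γ).trans_lt ?_)
  by_cases hmax : ∃ m ∈ γ, Maximal (· ∈ suppFP Q h) m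
  · obtain ⟨m, hmγ, hm⟩ := hmax
    obtain ⟨i, rfl⟩ := hb (mem_borderFP_of_maximal hm)
    have hlt : h' i < h i := by
      rw [hh' i, if_pos ⟨hm.prop, fun y hy hiy => (hm.eq_of_le hy hiy).symm⟩]
      exact Nat.sub_one_lt_of_le (hfp.2 i) le_rfl
    exact (score_lt_score hle hmγ hlt).trans_le (score_le_maxscore hγ hhead)
  · exact (score_mono hle γ).trans_lt
      (score_lt_maxscore_of_forall_not_maximal hγ hhead hq fun m hmγ hm => hmax ⟨m, hmγ, hm⟩)
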